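/- Let n be a high extremal point of J, let m be the next high extremal point after n (i.e., m is a high extremal point, m > n, and there is no high extremal point strictly between n and m), and set f := n − J(n) and r := n mod 2. Then, as integers, 2·m = 3·n + 1 + (1 − r)·(2·f − 1). -/

import Mathlib

/-- The Josephus function with reduction constant 3:
`J 1 = 1` and `J n = ((J (n-1) + 2) % n) + 1` for `n ≥ 2`. -/
def J : ℕ → ℕ
  | 0 => 0
  | 1 => 1
  | n + 2 => (J (n + 1) + 2) % (n + 2) + 1

/-- `n ≥ 1` is a high extremal point if `J n ∈ {n-1, n}`. -/
def IsHighExtremal (n : ℕ) : Prop := 1 ≤ n ∧ (J n = n - 1 ∨ J n = n)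

lemma J_succ {n : ℕ} (hn : 1 ≤ n) : J (n + 1) = (J n + 2) % (n + 1) + 1 := by
  obtain ⟨k, rfl⟩ : ∃ k, n = k + 1 := ⟨n - 1, by omega⟩
  rfl

/-- After a high extremal point `n` with fixed point indicator `g`, the function `J` restarts at
`2 - g` and grows in steps of `3` until it reaches the diagonal again. -/
lemma J_add_of_high {n g : ℕ} (hn : 1 ≤ n) (hg : g ≤ 1) (hJ : J n + g = n) (k : ℕ)
    (hk : 2 * k + 1 ≤ n + g) : J (n + 1 + k) + g = 2 + 3 * k := by
  induction k with
  | zero =>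
    have hmod : (J n + 2) % (n + 1) = 1 - g := by
      rw [show J n + 2 = (1 - g) + (n + 1) by omega, Nat.add_mod_right,
        Nat.mod_eq_of_lt (by omega)]
    rw [add_zero, J_succ hn, hmod]
    omega
  | succ k ih =>
    have hk' := ih (by omega)
    rw [← add_assoc, J_succ (by omega), Nat.mod_eq_of_lt (by omega)]
    omega

theorem stmt_6 (n m : ℕ) (hn : IsHighExtremal n)
    (hm : IsHighExtremal m) (hlt : n < m)
    (hnext : ∀ k, n < k → k < m → ¬ IsHighExtremal k)
    (f r : ℤ) (hf : f = (n : ℤ) - (J n : ℤ)) (hr : r = (n : ℤ) % 2) :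
    2 * (m : ℤ) = 3 * (n : ℤ) + 1 + (1 - r) * (2 * f - 1) := by
  obtain ⟨hn1, hJn⟩ := hn
  obtain ⟨g, hg, hJ⟩ : ∃ g, g ≤ 1 ∧ J n + g = n := by
    rcases hJn with h | h
    · exact ⟨1, le_rfl, by omega⟩
    · exact ⟨0, by omega, by omega⟩
  have hfg : f = g := by omega
  obtain ⟨K, hK⟩ : ∃ K, K = (n + g - 1) / 2 := ⟨_, rfl⟩
  have hJK := J_add_of_high hn1 hg hJ K (by omega)
  have hmK : m ≤ n + 1 + K := by
    by_contra! h
    exact hnext (n + 1 + K) (by omega) h ⟨by omega, by omega⟩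
  obtain ⟨k, rfl⟩ : ∃ k, m = n + 1 + k := ⟨m - (n + 1), by omega⟩
  have hJk := J_add_of_high hn1 hg hJ k (by omega)
  have hk := hm.2
  rcases Int.emod_two_eq_zero_or_one n with h | h <;> rw [hr, h] <;> omega
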